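/- For every n ≥ 0, in a uniformly random spanning tree t of G_n the corner u_1 has degree 1 with probability 11/14 − (5/42)·15^{−n} and degree 2 with probability 3/14 + (5/42)·15^{−n} (and these are the only possible degrees). In particular these probabilities converge to 11/14 and 3/14 as n → ∞. -/

import Mathlib

attribute [local instance] Classical.propDecidable

noncomputable section

/-- Points in the plane. -/
abbrev Pt : Type := ℝ × ℝ

/-- The three corner vertices `u₁ = (0,0)`, `u₂ = (1,0)`, `u₃ = (1/2, √3/2)`. -/
def cornerPt : Fin 3 → Pt
  | 0 => (0, 0)
  | 1 => (1, 0)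
  | 2 => (1 / 2, Real.sqrt 3 / 2)

/-- The similitude `ψ_i(x) = (x + u_i)/2`. -/
def psi (i : Fin 3) (x : Pt) : Pt := ((x.1 + (cornerPt i).1) / 2, (x.2 + (cornerPt i).2) / 2)

/-- Vertex set of the Sierpiński graph `G_n`. -/
def sierpV : ℕ → Finset Pt
  | 0 => {cornerPt 0, cornerPt 1, cornerPt 2}
  | n + 1 => (sierpV n).image (psi 0) ∪ (sierpV n).image (psi 1) ∪ (sierpV n).image (psi 2)

/-- Edge set of the Sierpiński graph `G_n`. -/
def sierpE : ℕ → Finset (Sym2 Pt)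
  | 0 => {s(cornerPt 0, cornerPt 1), s(cornerPt 1, cornerPt 2), s(cornerPt 2, cornerPt 0)}
  | n + 1 =>
      (sierpE n).image (Sym2.map (psi 0)) ∪ (sierpE n).image (Sym2.map (psi 1)) ∪
        (sierpE n).image (Sym2.map (psi 2))

/-- The simple graph spanned by a finite set of edges. -/
def graphOf (F : Finset (Sym2 Pt)) : SimpleGraph Pt := SimpleGraph.fromEdgeSet ↑F

/-- Spanning trees of `G_n`: acyclic edge subsets connecting all vertices of `G_n`. -/
def treeSet (n : ℕ) : Finset (Finset (Sym2 Pt)) :=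
  (sierpE n).powerset.filter fun F =>
    (graphOf F).IsAcyclic ∧ ∀ x ∈ sierpV n, ∀ y ∈ sierpV n, (graphOf F).Reachable x y

/-- `S_n^i` (with `i : Fin 3` zero-based): spanning forests of `G_n` with exactly two
components, one containing corner `i`, the other containing the two remaining corners. -/
def twoForestSet (n : ℕ) (i : Fin 3) : Finset (Finset (Sym2 Pt)) :=
  (sierpE n).powerset.filter fun F =>
    (graphOf F).IsAcyclic ∧
    (∀ j, j ≠ i → ¬ (graphOf F).Reachable (cornerPt i) (cornerPt j)) ∧
    (∀ j k, j ≠ i → k ≠ i → (graphOf F).Reachable (cornerPt j) (cornerPt k)) ∧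
    (∀ x ∈ sierpV n, ∃ j, (graphOf F).Reachable (cornerPt j) x)

/-- `R_n`: spanning forests of `G_n` with exactly three components, each containing
exactly one corner vertex. -/
def threeForestSet (n : ℕ) : Finset (Finset (Sym2 Pt)) :=
  (sierpE n).powerset.filter fun F =>
    (graphOf F).IsAcyclic ∧
    (∀ j k, j ≠ k → ¬ (graphOf F).Reachable (cornerPt j) (cornerPt k)) ∧
    (∀ x ∈ sierpV n, ∃ j, (graphOf F).Reachable (cornerPt j) x)

/-- Edges of the copy `ψ_i(G_n)` inside `G_{n+1}`. -/
def psiCellE (i : Fin 3) (n : ℕ) : Finset (Sym2 Pt) := (sierpE n).image (Sym2.map (psi i))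

/-- The class `T_n^i`: for `n ≥ 1`, spanning trees whose unique path from corner `i`
to any other corner `j` stays in `ψ_i(G_{n-1}) ∪ ψ_j(G_{n-1})`; for `n = 0` the
singleton consisting of the two edges of `G_0` incident with corner `i`. -/
def treeClass : ℕ → Fin 3 → Finset (Finset (Sym2 Pt))
  | 0, i => {(sierpE 0).filter fun e => cornerPt i ∈ e}
  | n + 1, i =>
      (treeSet (n + 1)).filter fun F =>
        ∀ j, j ≠ i → ∀ p : (graphOf F).Walk (cornerPt i) (cornerPt j), p.IsPath →
          ∀ e ∈ p.edges, e ∈ psiCellE i n ∪ psiCellE j n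

/-- `ψ_w = ψ_{w₁} ∘ ⋯ ∘ ψ_{w_k}` for a word `w` of length `k`. -/
def psiWord {k : ℕ} (w : Fin k → Fin 3) : Pt → Pt :=
  (List.ofFn w).foldr (fun i g => psi i ∘ g) id

/-- The restriction `π_w(F) = ψ_w^{-1}(F ∩ ψ_w(G_{m-k}))` of an edge set `F ⊆ E G_m`
to the `k`-part indexed by the word `w`, as a subgraph of `G_{m-k}`. -/
def restrictE {k : ℕ} (w : Fin k → Fin 3) (m : ℕ) (F : Finset (Sym2 Pt)) :
    Finset (Sym2 Pt) :=
  (sierpE (m - k)).filter fun e => Sym2.map (psiWord w) e ∈ F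

/-- Number of connected components of the subgraph with edge set `F`,
on the vertex set of `G_m`. -/
def ncomp (m : ℕ) (F : Finset (Sym2 Pt)) : ℕ :=
  Set.ncard {C : Set Pt | ∃ v ∈ sierpV m, C = {x : Pt | x ∈ sierpV m ∧ (graphOf F).Reachable v x}}

/-- Degree of `v` in the edge set `F`. -/
def degIn (F : Finset (Sym2 Pt)) (v : Pt) : ℕ := (F.filter fun e => v ∈ e).card

/-- The subgraph of `G_0` replacing a forest in `Q_1`, used in the trace construction. -/
def traceCell (g : Finset (Sym2 Pt)) : Finset (Sym2 Pt) :=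
  if g ∈ treeClass 1 0 then (sierpE 0).filter (fun e => cornerPt 0 ∈ e)
  else if g ∈ treeClass 1 1 then (sierpE 0).filter (fun e => cornerPt 1 ∈ e)
  else if g ∈ treeClass 1 2 then (sierpE 0).filter (fun e => cornerPt 2 ∈ e)
  else if g ∈ twoForestSet 1 0 then (sierpE 0).filter (fun e => cornerPt 0 ∉ e)
  else if g ∈ twoForestSet 1 1 then (sierpE 0).filter (fun e => cornerPt 1 ∉ e)
  else if g ∈ twoForestSet 1 2 then (sierpE 0).filter (fun e => cornerPt 2 ∉ e)
  else ∅

/-- The trace `Tr f ⊆ E G_n` of an edge set `f ⊆ E G_{n+1}`. -/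
def trace (n : ℕ) (f : Finset (Sym2 Pt)) : Finset (Sym2 Pt) :=
  Finset.univ.biUnion fun w : Fin n → Fin 3 =>
    (traceCell (restrictE w (n + 1) f)).image (Sym2.map (psiWord w))

/-- `Q_n = T_n ∪ S_n^1 ∪ S_n^2 ∪ S_n^3 ∪ R_n`. -/
def qSet (n : ℕ) : Finset (Finset (Sym2 Pt)) :=
  treeSet n ∪ twoForestSet n 0 ∪ twoForestSet n 1 ∪ twoForestSet n 2 ∪ threeForestSet n

open Filter

lemma graphOf_adj {F : Finset (Sym2 Pt)} {a b : Pt} :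
    (graphOf F).Adj a b ↔ s(a, b) ∈ F ∧ a ≠ b := by
  simp [graphOf]

lemma graphOf_mono {F F' : Finset (Sym2 Pt)} (h : F ⊆ F') : graphOf F ≤ graphOf F' :=
  SimpleGraph.fromEdgeSet_mono (by exact_mod_cast h)

lemma graphOf_insert (F : Finset (Sym2 Pt)) (x y : Pt) :
    graphOf (insert s(x, y) F) = graphOf F ⊔ SimpleGraph.edge x y := by
  ext a b
  simp only [graphOf_adj, SimpleGraph.sup_adj, SimpleGraph.edge_adj, Finset.mem_insert,
    Sym2.eq_iff]
  tauto

lemma reachable_insert {F : Finset (Sym2 Pt)} {x y a b : Pt}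
    (h : (graphOf (insert s(x, y) F)).Reachable a b) :
    (graphOf F).Reachable a b ∨ ((graphOf F).Reachable a x ∧ (graphOf F).Reachable y b) ∨
      ((graphOf F).Reachable a y ∧ (graphOf F).Reachable x b) := by
  rw [SimpleGraph.reachable_iff_reflTransGen] at h
  induction h with
  | refl => exact Or.inl (SimpleGraph.Reachable.refl _)
  | @tail c d _ hcd ih =>
    rw [graphOf_adj, Finset.mem_insert] at hcd
    obtain ⟨hcd | hcd, hne⟩ := hcd
    · rcases Sym2.eq_iff.mp hcd with ⟨rfl, rfl⟩ | ⟨rfl, rfl⟩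
      · rcases ih with ih | ⟨h1, h2⟩ | ⟨h1, h2⟩
        · exact Or.inr (Or.inl ⟨ih, .refl _⟩)
        · exact Or.inr (Or.inl ⟨h1, .refl _⟩)
        · exact Or.inl h1
      · rcases ih with ih | ⟨h1, h2⟩ | ⟨h1, h2⟩
        · exact Or.inr (Or.inr ⟨ih, .refl _⟩)
        · exact Or.inl h1
        · exact Or.inr (Or.inr ⟨h1, .refl _⟩)
    · have hr : (graphOf F).Reachable c d := (graphOf_adj.mpr ⟨hcd, hne⟩).reachable
      rcases ih with ih | ⟨h1, h2⟩ | ⟨h1, h2⟩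
      · exact Or.inl (ih.trans hr)
      · exact Or.inr (Or.inl ⟨h1, h2.trans hr⟩)
      · exact Or.inr (Or.inr ⟨h1, h2.trans hr⟩)

/-- `S` contains exactly one vertex of each component of the graph with vertices `V`
and edges `F`. -/
structure IsTransversal (F : Finset (Sym2 Pt)) (V S : Finset Pt) : Prop where
  subset : S ⊆ V
  cover : ∀ v ∈ V, ∃ s ∈ S, (graphOf F).Reachable s v
  separated : ∀ s ∈ S, ∀ s' ∈ S, (graphOf F).Reachable s s' → s = s'

lemma IsTransversal.of_insert_of_reachable {F : Finset (Sym2 Pt)} {V S : Finset Pt} {x y : Pt}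
    (hS : IsTransversal (insert s(x, y) F) V S) (hxy : (graphOf F).Reachable x y) :
    IsTransversal F V S where
  subset := hS.subset
  cover v hv := by
    obtain ⟨s, hs, hr⟩ := hS.cover v hv
    refine ⟨s, hs, ?_⟩
    rcases reachable_insert hr with h | ⟨h1, h2⟩ | ⟨h1, h2⟩
    · exact h
    · exact (h1.trans hxy).trans h2
    · exact (h1.trans hxy.symm).trans h2
  separated s hs s' hs' h :=
    hS.separated s hs s' hs' (h.mono (graphOf_mono (Finset.subset_insert _ _)))

lemma IsTransversal.exists_of_insert {F : Finset (Sym2 Pt)} {V S : Finset Pt} {x y : Pt}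
    (hS : IsTransversal (insert s(x, y) F) V S) (hx : x ∈ V) (hy : y ∈ V) (hne : x ≠ y)
    (hxy : ¬ (graphOf F).Reachable x y) :
    ∃ S', S'.card = S.card + 1 ∧ IsTransversal F V S' := by
  have hle := graphOf_mono (Finset.subset_insert s(x, y) F)
  have hadj : (graphOf (insert s(x, y) F)).Reachable x y :=
    (graphOf_adj.mpr ⟨Finset.mem_insert_self _ _, hne⟩).reachable
  obtain ⟨s, hs, hsx⟩ := hS.cover x hx
  have key : ∀ z w : Pt, z ∈ V → w ∈ V → s(z, w) = s(x, y) →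
      ¬ (graphOf F).Reachable s w → ∃ S', S'.card = S.card + 1 ∧ IsTransversal F V S' := by
    intro z w hz hw hzw hnr
    have hsw : (graphOf (insert s(x, y) F)).Reachable s w := by
      rcases Sym2.eq_iff.mp hzw with ⟨rfl, rfl⟩ | ⟨rfl, rfl⟩
      · exact hsx.trans hadj
      · exact hsx
    have hw_sep : ∀ s' ∈ S, ¬ (graphOf F).Reachable s' w := by
      intro s' hs' h
      have := hS.separated s hs s' hs' (hsw.trans (h.mono hle).symm)
      exact hnr (this ▸ h)
    have hwS : w ∉ S := fun h => hw_sep w h (.refl _)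
    refine ⟨insert w S, Finset.card_insert_of_notMem hwS, ?_, ?_, ?_⟩
    · exact Finset.insert_subset hw hS.subset
    · intro v hv
      obtain ⟨t, ht, hr⟩ := hS.cover v hv
      rw [← hzw] at hr
      rcases reachable_insert hr with h | ⟨h1, h2⟩ | ⟨h1, h2⟩
      · exact ⟨t, Finset.mem_insert_of_mem ht, h⟩
      · exact ⟨w, Finset.mem_insert_self _ _, h2⟩
      · exact absurd h1 (hw_sep t ht)
    · intro a ha b hb hab
      rcases Finset.mem_insert.mp ha with rfl | ha' <;>
        rcases Finset.mem_insert.mp hb with rfl | hb'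
      · rfl
      · exact absurd hab.symm (hw_sep b hb')
      · exact absurd hab (hw_sep a ha')
      · exact hS.separated a ha' b hb' (hab.mono hle)
  by_cases h : (graphOf F).Reachable s y
  · refine key y x hy hx Sym2.eq_swap fun h' => hxy (h'.symm.trans h)
  · exact key x y hx hy rfl h

lemma IsTransversal.card_le_and_isAcyclic_iff {V : Finset Pt} (F : Finset (Sym2 Pt)) :
    (∀ a b, s(a, b) ∈ F → a ∈ V ∧ b ∈ V ∧ a ≠ b) → ∀ S, IsTransversal F V S →
      V.card ≤ F.card + S.card ∧ ((graphOf F).IsAcyclic ↔ F.card + S.card = V.card) := by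
  induction F using Finset.induction_on with
  | empty =>
    intro _ S hS
    have hbot : graphOf ∅ = ⊥ := by ext; simp [graphOf_adj]
    have : S = V := by
      refine hS.subset.antisymm fun v hv => ?_
      obtain ⟨s, hs, h⟩ := hS.cover v hv
      rw [hbot, SimpleGraph.reachable_bot] at h
      exact h ▸ hs
    simp [this, hbot]
  | insert e F he ih =>
    intro hF S hS
    induction e using Sym2.ind with
    | _ x y =>
    obtain ⟨hx, hy, hne⟩ := hF x y (Finset.mem_insert_self _ _)
    replace ih := ih fun a b h => hF a b (Finset.mem_insert_of_mem h)
    rw [Finset.card_insert_of_notMem he, graphOf_insert,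
      SimpleGraph.isAcyclic_sup_fromEdgeSet_iff]
    by_cases hxy : (graphOf F).Reachable x y
    · have := (ih S (hS.of_insert_of_reachable hxy)).1
      refine ⟨by omega, iff_of_false ?_ (by omega)⟩
      rintro ⟨-, h⟩
      rcases h hxy with h | h
      · exact hne h
      · exact he (graphOf_adj.mp h).1
    · obtain ⟨S', hc, hS'⟩ := hS.exists_of_insert hx hy hne hxy
      obtain ⟨h1, h2⟩ := ih S' hS'
      refine ⟨by omega, ?_⟩
      rw [h2]
      constructor
      · rintro ⟨h, -⟩
        omega
      · intro h
        exact ⟨by omega, fun h => absurd h hxy⟩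

lemma psi_injective (i : Fin 3) : Function.Injective (psi i) := by
  intro a b h
  simp only [psi, Prod.mk.injEq] at h
  ext <;> linarith [h.1, h.2]

lemma psi_cornerPt_self (i : Fin 3) : psi i (cornerPt i) = cornerPt i := by
  ext <;> simp [psi]

lemma psi_cornerPt_comm (i j : Fin 3) : psi i (cornerPt j) = psi j (cornerPt i) := by
  ext <;> simp only [psi] <;> ring

lemma cornerPt_injective : Function.Injective cornerPt := by
  intro i j h
  fin_cases i <;> fin_cases j <;> simp [cornerPt] at h ⊢

lemma mem_sierpV_zero {x : Pt} : x ∈ sierpV 0 ↔ ∃ i, cornerPt i = x := by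
  simp [sierpV, Fin.exists_fin_succ, eq_comm]

lemma mem_sierpV_succ {n : ℕ} {x : Pt} :
    x ∈ sierpV (n + 1) ↔ ∃ i, ∃ y ∈ sierpV n, psi i y = x := by
  simp [sierpV, Fin.exists_fin_succ]

lemma mem_sierpE_zero {e : Sym2 Pt} :
    e ∈ sierpE 0 ↔ ∃ i : Fin 3, s(cornerPt (i + 1), cornerPt (i + 2)) = e := by
  simp only [sierpE, Finset.mem_insert, Finset.mem_singleton, Fin.exists_fin_succ]
  simp [eq_comm]
  tauto

lemma mem_sierpE_succ {n : ℕ} {e : Sym2 Pt} :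
    e ∈ sierpE (n + 1) ↔ ∃ i, ∃ e' ∈ sierpE n, Sym2.map (psi i) e' = e := by
  simp [sierpE, Fin.exists_fin_succ]

lemma cornerPt_mem_sierpV (n : ℕ) (i : Fin 3) : cornerPt i ∈ sierpV n := by
  induction n with
  | zero => exact mem_sierpV_zero.mpr ⟨i, rfl⟩
  | succ n ih => exact mem_sierpV_succ.mpr ⟨i, _, ih, psi_cornerPt_self i⟩

lemma psi_mem_sierpV {n : ℕ} (i : Fin 3) {x : Pt} (hx : x ∈ sierpV n) :
    psi i x ∈ sierpV (n + 1) :=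
  mem_sierpV_succ.mpr ⟨i, x, hx, rfl⟩

lemma cornerPt_fst (i : Fin 3) :
    (cornerPt i).1 = if i = 2 then 1 / 2 else if i = 1 then 1 else 0 := by
  fin_cases i <;> simp [cornerPt]

lemma cornerPt_snd_div (i : Fin 3) :
    (cornerPt i).2 / √3 = if i = 2 then 1 / 2 else 0 := by
  have : √3 ≠ 0 := by positivity
  fin_cases i <;> simp [cornerPt]
  field_simp

/-- The vertices lie in the triangle spanned by the corners. -/
lemma sierpV_mem_triangle {n : ℕ} {x : Pt} (hx : x ∈ sierpV n) :
    0 ≤ x.2 / √3 ∧ x.2 / √3 ≤ x.1 ∧ x.1 + x.2 / √3 ≤ 1 := by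
  have hc (i : Fin 3) : 0 ≤ (cornerPt i).2 / √3 ∧ (cornerPt i).2 / √3 ≤ (cornerPt i).1 ∧
      (cornerPt i).1 + (cornerPt i).2 / √3 ≤ 1 := by
    rw [cornerPt_snd_div, cornerPt_fst]
    fin_cases i <;> simp
    norm_num
  induction n generalizing x with
  | zero =>
    obtain ⟨i, rfl⟩ := mem_sierpV_zero.mp hx
    exact hc i
  | succ n ih =>
    obtain ⟨i, y, hy, rfl⟩ := mem_sierpV_succ.mp hx
    have h := ih hy
    have h' := hc i
    have e : (psi i y).2 / √3 = (y.2 / √3 + (cornerPt i).2 / √3) / 2 := by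
      simp only [psi]; ring
    have e' : (psi i y).1 = (y.1 + (cornerPt i).1) / 2 := rfl
    rw [e, e']
    refine ⟨?_, ?_, ?_⟩ <;> linarith [h.1, h.2.1, h.2.2, h'.1, h'.2.1, h'.2.2]

/-- Distinct cells meet only in their common corner. -/
lemma eq_cornerPt_of_psi_eq {n : ℕ} {i k : Fin 3} {x y : Pt} (hx : x ∈ sierpV n)
    (hy : y ∈ sierpV n) (hik : i ≠ k) (h : psi i x = psi k y) :
    x = cornerPt k ∧ y = cornerPt i := by
  have hs : √3 ≠ 0 := by positivity
  obtain ⟨a1, a2, a3⟩ := sierpV_mem_triangle hx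
  obtain ⟨b1, b2, b3⟩ := sierpV_mem_triangle hy
  have h1 : x.1 + (cornerPt i).1 = y.1 + (cornerPt k).1 := by
    have := congrArg Prod.fst h
    simp only [psi] at this
    linarith
  have h2 : x.2 / √3 + (cornerPt i).2 / √3 = y.2 / √3 + (cornerPt k).2 / √3 := by
    have := congrArg Prod.snd h
    simp only [psi] at this
    rw [← add_div, ← add_div]
    congr 1
    linarith
  have key : ∀ (z : Pt) (j : Fin 3), z.1 = (cornerPt j).1 →
      z.2 / √3 = (cornerPt j).2 / √3 → z = cornerPt j := by
    intro z j e1 e2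
    ext
    · exact e1
    · exact (div_left_inj' hs).mp e2
  rw [cornerPt_snd_div, cornerPt_snd_div] at h2
  rw [cornerPt_fst, cornerPt_fst] at h1
  constructor <;> apply key <;> first | rw [cornerPt_fst] | rw [cornerPt_snd_div]
  all_goals
    clear key h hx hy
    generalize x.2 / √3 = s at *
    generalize y.2 / √3 = t at *
    fin_cases i <;> fin_cases k <;> simp at hik h1 h2 ⊢ <;> linarith

lemma sierpE_endpoints {n : ℕ} {a b : Pt} (h : s(a, b) ∈ sierpE n) :
    a ∈ sierpV n ∧ b ∈ sierpV n ∧ a ≠ b := by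
  induction n generalizing a b with
  | zero =>
    obtain ⟨i, hi⟩ := mem_sierpE_zero.mp h
    have hne : cornerPt (i + 1) ≠ cornerPt (i + 2) := by
      rw [cornerPt_injective.ne_iff]
      clear hi
      revert i
      decide
    rcases Sym2.eq_iff.mp hi with ⟨rfl, rfl⟩ | ⟨rfl, rfl⟩
    · exact ⟨cornerPt_mem_sierpV _ _, cornerPt_mem_sierpV _ _, hne⟩
    · exact ⟨cornerPt_mem_sierpV _ _, cornerPt_mem_sierpV _ _, hne.symm⟩
  | succ n ih =>
    obtain ⟨i, e, he, hi⟩ := mem_sierpE_succ.mp h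
    induction e using Sym2.ind with
    | _ x y =>
    obtain ⟨hx, hy, hne⟩ := ih he
    have hne := (psi_injective i).ne hne
    rw [Sym2.map_mk] at hi
    rcases Sym2.eq_iff.mp hi with ⟨rfl, rfl⟩ | ⟨rfl, rfl⟩
    · exact ⟨psi_mem_sierpV i hx, psi_mem_sierpV i hy, hne⟩
    · exact ⟨psi_mem_sierpV i hy, psi_mem_sierpV i hx, hne.symm⟩

/-- Distinct cells have no common edge. -/
lemma map_psi_eq_map_psi {n : ℕ} {i k : Fin 3} {e e' : Sym2 Pt} (he : e ∈ sierpE n)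
    (he' : e' ∈ sierpE n) (h : Sym2.map (psi i) e = Sym2.map (psi k) e') : i = k ∧ e = e' := by
  by_cases hik : i = k
  · subst hik
    exact ⟨rfl, Sym2.map.injective (psi_injective i) h⟩
  · exfalso
    induction e using Sym2.ind with
    | _ x y =>
    induction e' using Sym2.ind with
    | _ x' y' =>
    obtain ⟨hx, hy, hne⟩ := sierpE_endpoints he
    obtain ⟨hx', hy', -⟩ := sierpE_endpoints he'
    rw [Sym2.map_mk, Sym2.map_mk] at h
    rcases Sym2.eq_iff.mp h with ⟨h1, h2⟩ | ⟨h1, h2⟩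
    · exact hne ((eq_cornerPt_of_psi_eq hx hx' hik h1).1.trans
        (eq_cornerPt_of_psi_eq hy hy' hik h2).1.symm)
    · exact hne ((eq_cornerPt_of_psi_eq hx hy' hik h1).1.trans
        (eq_cornerPt_of_psi_eq hy hx' hik h2).1.symm)

lemma card_sierpV_zero : (sierpV 0).card = 3 := by
  have : sierpV 0 = Finset.univ.image cornerPt := by
    ext x
    simp [mem_sierpV_zero]
  rw [this, Finset.card_image_of_injective _ cornerPt_injective]
  rfl

lemma card_sierpV_succ (n : ℕ) : (sierpV (n + 1)).card + 3 = 3 * (sierpV n).card := by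
  have hinter (i k : Fin 3) (hik : i ≠ k) :
      (sierpV n).image (psi i) ∩ (sierpV n).image (psi k) = {psi i (cornerPt k)} := by
    ext x
    simp only [Finset.mem_inter, Finset.mem_image, Finset.mem_singleton]
    constructor
    · rintro ⟨⟨y, hy, rfl⟩, z, hz, h⟩
      rw [(eq_cornerPt_of_psi_eq hy hz hik h.symm).1]
    · rintro rfl
      exact ⟨⟨_, cornerPt_mem_sierpV n k, rfl⟩, _, cornerPt_mem_sierpV n i,
        psi_cornerPt_comm k i⟩
  have hcard (i : Fin 3) : ((sierpV n).image (psi i)).card = (sierpV n).card :=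
    Finset.card_image_of_injective _ (psi_injective i)
  have h1 := Finset.card_union_add_card_inter ((sierpV n).image (psi 0)) ((sierpV n).image (psi 1))
  have h2 := Finset.card_union_add_card_inter
    ((sierpV n).image (psi 0) ∪ (sierpV n).image (psi 1)) ((sierpV n).image (psi 2))
  have hne : psi 0 (cornerPt 2) ≠ psi 1 (cornerPt 2) := by
    intro h
    have := (eq_cornerPt_of_psi_eq (cornerPt_mem_sierpV n 2) (cornerPt_mem_sierpV n 2)
      (by decide) h).1
    exact absurd (cornerPt_injective this) (by decide)
  rw [hinter 0 1 (by decide), Finset.card_singleton, hcard, hcard] at h1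
  rw [Finset.union_inter_distrib_right, hinter 0 2 (by decide), hinter 1 2 (by decide),
    Finset.singleton_union, Finset.card_pair hne, hcard] at h2
  change (_ ∪ _ ∪ _ : Finset Pt).card + 3 = _
  omega

/-- The edge set in `G_{n+1}` whose part in the cell `i` is `F i`. -/
def glue (F : Fin 3 → Finset (Sym2 Pt)) : Finset (Sym2 Pt) :=
  Finset.univ.biUnion fun i => (F i).image (Sym2.map (psi i))

/-- The part of an edge set of `G_{n+1}` in each of the three cells. -/
def unglue (n : ℕ) (F : Finset (Sym2 Pt)) (i : Fin 3) : Finset (Sym2 Pt) :=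
  (sierpE n).filter fun e => Sym2.map (psi i) e ∈ F

lemma mem_glue {F : Fin 3 → Finset (Sym2 Pt)} {e : Sym2 Pt} :
    e ∈ glue F ↔ ∃ i, ∃ e' ∈ F i, Sym2.map (psi i) e' = e := by
  simp [glue]

lemma unglue_glue {n : ℕ} {F : Fin 3 → Finset (Sym2 Pt)} (hF : ∀ i, F i ⊆ sierpE n) :
    unglue n (glue F) = F := by
  funext i
  ext e
  simp only [unglue, Finset.mem_filter, mem_glue]
  constructor
  · rintro ⟨he, k, e', he', h⟩
    obtain ⟨rfl, rfl⟩ := map_psi_eq_map_psi (hF k he') he h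
    exact he'
  · exact fun he => ⟨hF i he, i, e, he, rfl⟩

lemma glue_unglue {n : ℕ} {F : Finset (Sym2 Pt)} (hF : F ⊆ sierpE (n + 1)) :
    glue (unglue n F) = F := by
  ext e
  simp only [unglue, Finset.mem_filter, mem_glue]
  constructor
  · rintro ⟨i, e', ⟨-, h⟩, rfl⟩
    exact h
  · intro he
    obtain ⟨i, e', he', rfl⟩ := mem_sierpE_succ.mp (hF he)
    exact ⟨i, e', ⟨he', he⟩, rfl⟩

lemma glue_subset {n : ℕ} {F : Fin 3 → Finset (Sym2 Pt)} (hF : ∀ i, F i ⊆ sierpE n) :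
    glue F ⊆ sierpE (n + 1) := by
  intro e he
  obtain ⟨i, e', he', rfl⟩ := mem_glue.mp he
  exact mem_sierpE_succ.mpr ⟨i, e', hF i he', rfl⟩

lemma card_glue {n : ℕ} {F : Fin 3 → Finset (Sym2 Pt)} (hF : ∀ i, F i ⊆ sierpE n) :
    (glue F).card = (F 0).card + (F 1).card + (F 2).card := by
  rw [glue, Finset.card_biUnion, Fin.sum_univ_three]
  · simp only [Finset.card_image_of_injective _ (Sym2.map.injective (psi_injective _))]
  · intro i _ k _ hik
    rw [Function.onFun, Finset.disjoint_left]
    simp only [Finset.mem_image, not_exists, not_and]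
    rintro _ ⟨e, he, rfl⟩ e' he' h
    exact hik (map_psi_eq_map_psi (hF k he') (hF i he) h).1.symm

lemma degIn_glue {n : ℕ} {F : Fin 3 → Finset (Sym2 Pt)} (hF : ∀ i, F i ⊆ sierpE n) :
    degIn (glue F) (cornerPt 0) = degIn (F 0) (cornerPt 0) := by
  have : (glue F).filter (fun e => cornerPt 0 ∈ e) =
      ((F 0).filter fun e => cornerPt 0 ∈ e).image (Sym2.map (psi 0)) := by
    ext e
    simp only [Finset.mem_filter, Finset.mem_image, mem_glue]
    constructor
    · rintro ⟨⟨i, e, he, rfl⟩, h⟩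
      obtain ⟨a, ha, hc⟩ := Sym2.mem_map.mp h
      have haV : a ∈ sierpV n := by
        obtain ⟨b, rfl⟩ := ha
        exact (sierpE_endpoints (hF i he)).1
      rw [← psi_cornerPt_self] at hc
      by_cases hi : i = 0
      · subst hi
        exact ⟨e, ⟨he, psi_injective _ hc ▸ ha⟩, rfl⟩
      · have := (eq_cornerPt_of_psi_eq haV (cornerPt_mem_sierpV n 0) hi hc).2
        exact absurd (cornerPt_injective this).symm hi
    · rintro ⟨e, ⟨he, h⟩, rfl⟩
      exact ⟨⟨0, e, he, rfl⟩, Sym2.mem_map.mpr ⟨_, h, psi_cornerPt_self 0⟩⟩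
  rw [degIn, degIn, this, Finset.card_image_of_injective _ (Sym2.map.injective (psi_injective _))]

lemma glue_adj {F : Fin 3 → Finset (Sym2 Pt)} {i : Fin 3} {a b : Pt} (h : (graphOf (F i)).Adj a b) :
    (graphOf (glue F)).Adj (psi i a) (psi i b) := by
  rw [graphOf_adj] at h ⊢
  exact ⟨mem_glue.mpr ⟨i, _, h.1, Sym2.map_mk ..⟩, (psi_injective i).ne h.2⟩

lemma glue_reachable {F : Fin 3 → Finset (Sym2 Pt)} {i : Fin 3} {a b : Pt}
    (h : (graphOf (F i)).Reachable a b) : (graphOf (glue F)).Reachable (psi i a) (psi i b) := by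
  rw [SimpleGraph.reachable_iff_reflTransGen] at h ⊢
  exact h.lift (psi i) fun _ _ => glue_adj

lemma isAcyclic_of_glue {F : Fin 3 → Finset (Sym2 Pt)} (h : (graphOf (glue F)).IsAcyclic)
    (i : Fin 3) : (graphOf (F i)).IsAcyclic :=
  h.comap ⟨psi i, glue_adj⟩ (psi_injective i)

/-- A walk in the glued graph which starts in a corner of a cell can be followed cell by cell,
recording only the corners through which it passes. -/
lemma exists_of_glue_reachable {n : ℕ} {F : Fin 3 → Finset (Sym2 Pt)} (hF : ∀ i, F i ⊆ sierpE n)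
    (X : Fin 3 → Fin 3 → Prop) (hswap : ∀ i j, X i j → X j i)
    (hcell : ∀ i j k, (graphOf (F i)).Reachable (cornerPt j) (cornerPt k) → X i j → X i k)
    {i₀ j₀ : Fin 3} (h₀ : X i₀ j₀) {y : Pt}
    (hy : (graphOf (glue F)).Reachable (psi i₀ (cornerPt j₀)) y) :
    ∃ i j, ∃ z ∈ sierpV n, y = psi i z ∧ X i j ∧ (graphOf (F i)).Reachable (cornerPt j) z := by
  rw [SimpleGraph.reachable_iff_reflTransGen] at hy
  induction hy with
  | refl => exact ⟨i₀, j₀, _, cornerPt_mem_sierpV n j₀, rfl, h₀, .refl _⟩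
  | @tail y y' _ hadj ih =>
    obtain ⟨i, j, z, hz, rfl, hX, hr⟩ := ih
    obtain ⟨hmem, hne⟩ := graphOf_adj.mp hadj
    obtain ⟨k, e, he, hek⟩ := mem_glue.mp hmem
    obtain ⟨a, b, hab, hza, rfl⟩ : ∃ a b, s(a, b) ∈ F k ∧ psi k a = psi i z ∧ y' = psi k b := by
      induction e using Sym2.ind with
      | _ a b =>
      rw [Sym2.map_mk] at hek
      rcases Sym2.eq_iff.mp hek with ⟨h1, h2⟩ | ⟨h1, h2⟩
      · exact ⟨a, b, he, h1, h2.symm⟩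
      · exact ⟨b, a, Sym2.eq_swap ▸ he, h2, h1.symm⟩
    obtain ⟨ha, hb, hne'⟩ := sierpE_endpoints (hF k hab)
    have hab' : (graphOf (F k)).Reachable a b := (graphOf_adj.mpr ⟨hab, hne'⟩).reachable
    refine (em (k = i)).elim (fun hk => ?_) (fun hk => ?_)
    · subst hk
      obtain rfl := psi_injective k hza
      exact ⟨k, j, b, hb, rfl, hX, hr.trans hab'⟩
    · obtain ⟨rfl, rfl⟩ := eq_cornerPt_of_psi_eq ha hz hk hza
      exact ⟨k, i, b, hb, rfl, hswap _ _ (hcell _ _ _ hr hX), hab'⟩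

/-- The five partitions of the three corners: one block, `{i}` against the other two corners
for `i = 0, 1, 2`, and three blocks. A partition is given by labelling the corners. -/
def block : Fin 5 → Fin 3 → Fin 3
  | 0 => ![0, 0, 0]
  | 1 => ![0, 1, 1]
  | 2 => ![0, 1, 0]
  | 3 => ![0, 0, 1]
  | 4 => ![0, 1, 2]

/-- One representative of each block. -/
def blockReps : Fin 5 → Finset (Fin 3)
  | 0 => {0}
  | 1 => {0, 1}
  | 2 => {0, 1}
  | 3 => {0, 2}
  | 4 => {0, 1, 2}

lemma block_ext {σ τ : Fin 5} (h : ∀ j k, block σ j = block σ k ↔ block τ j = block τ k) :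
    σ = τ := by
  revert σ τ
  decide

lemma exists_block_eq_iff {r : Fin 3 → Fin 3 → Prop} (hr : Equivalence r) :
    ∃ σ, ∀ j k, r j k ↔ block σ j = block σ k := by
  have h0 := hr.refl
  have h1 : ∀ j k, r j k ↔ r k j := fun _ _ => ⟨hr.symm, hr.symm⟩
  have h2 := @hr.trans
  have e10 := h1 1 0
  have e20 := h1 2 0
  have e21 := h1 2 1
  have t1 := @h2 0 1 2
  have t2 := @h2 0 2 1
  have t3 := @h2 1 0 2
  by_cases a : r 0 1 <;> by_cases b : r 0 2 <;> by_cases c : r 1 2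
  · exact ⟨0, by simp [Fin.forall_fin_succ, block, *]⟩
  · tauto
  · tauto
  · exact ⟨3, by simp [Fin.forall_fin_succ, block, *]⟩
  · tauto
  · exact ⟨2, by simp [Fin.forall_fin_succ, block, *]⟩
  · exact ⟨1, by simp [Fin.forall_fin_succ, block, *]⟩
  · exact ⟨4, by simp [Fin.forall_fin_succ, block, *]⟩

lemma exists_mem_blockReps (σ : Fin 5) (k : Fin 3) : ∃ j ∈ blockReps σ, block σ j = block σ k := by
  revert σ k
  decide

lemma eq_of_mem_blockReps {σ : Fin 5} {j k : Fin 3} (hj : j ∈ blockReps σ) (hk : k ∈ blockReps σ)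
    (h : block σ j = block σ k) : j = k := by
  revert σ j k
  decide

/-- The components of `F` induce the partition `σ` of the corners, and each of them contains
a corner. -/
structure HasPartition (n : ℕ) (σ : Fin 5) (F : Finset (Sym2 Pt)) : Prop where
  reachable_iff : ∀ j k, (graphOf F).Reachable (cornerPt j) (cornerPt k) ↔ block σ j = block σ k
  cover : ∀ x ∈ sierpV n, ∃ j, (graphOf F).Reachable (cornerPt j) x

lemma HasPartition.isAcyclic_iff {n : ℕ} {σ : Fin 5} {F : Finset (Sym2 Pt)}
    (h : HasPartition n σ F) (hF : F ⊆ sierpE n) :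
    (graphOf F).IsAcyclic ↔ F.card + (blockReps σ).card = (sierpV n).card := by
  have hS : IsTransversal F (sierpV n) ((blockReps σ).image cornerPt) := by
    refine ⟨?_, ?_, ?_⟩
    · rw [Finset.image_subset_iff]
      exact fun j _ => cornerPt_mem_sierpV n j
    · intro v hv
      obtain ⟨k, hk⟩ := h.cover v hv
      obtain ⟨j, hj, hjk⟩ := exists_mem_blockReps σ k
      exact ⟨_, Finset.mem_image_of_mem _ hj, ((h.reachable_iff j k).mpr hjk).trans hk⟩
    · simp only [Finset.mem_image]
      rintro _ ⟨j, hj, rfl⟩ _ ⟨k, hk, rfl⟩ hjk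
      rw [eq_of_mem_blockReps hj hk ((h.reachable_iff j k).mp hjk)]
  rw [← Finset.card_image_of_injective (blockReps σ) cornerPt_injective]
  exact (hS.card_le_and_isAcyclic_iff F (fun a b hab => sierpE_endpoints (hF hab)) _).2

/-- Whether the cell `i` connects the corners `j` and `k`, if `p i` is the partition of its
corners. -/
def linked (p : Fin 3 → Fin 5) (i j k : Fin 3) : Bool := block (p i) j = block (p i) k

/-- A label of the component containing the common corner of the cells `i + 1` and `i + 2`. -/
def innerLabel (p : Fin 3 → Fin 5) : Fin 3 → ℕ
  | 0 => 0
  | 1 => bif linked p 2 0 1 || (linked p 0 1 2 && linked p 1 0 2) then 0 else 1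
  | 2 => bif linked p 1 0 2 || (linked p 0 1 2 && linked p 2 0 1) then 0 else
      bif linked p 0 1 2 then 1 else 2

/-- A label of the component containing the corner `i`. -/
def outerLabel (p : Fin 3 → Fin 5) (i : Fin 3) : ℕ :=
  bif linked p i i (i + 1) then innerLabel p (i + 2) else
    bif linked p i i (i + 2) then innerLabel p (i + 1) else 3 + i

/-- A label of the component containing the corner `j` of the cell `i`, in a graph glued from
three cells whose corners are partitioned according to `p`. -/
def label (p : Fin 3 → Fin 5) (i j : Fin 3) : ℕ :=
  bif i = j then outerLabel p i else innerLabel p (-(i + j))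

lemma label_swap (p : Fin 3 → Fin 5) (i j : Fin 3) : label p i j = label p j i := by
  by_cases h : i = j
  · rw [h]
  · simp [label, h, Ne.symm h, add_comm]

lemma label_eq_of_block_eq (p : Fin 3 → Fin 5) (i j k : Fin 3)
    (h : block (p i) j = block (p i) k) : label p i j = label p i k := by
  have hp : p = ![p 0, p 1, p 2] := by
    funext i
    fin_cases i <;> rfl
  rw [hp] at h ⊢
  generalize p 0 = a at h ⊢
  generalize p 1 = b at h ⊢
  generalize p 2 = c at h ⊢
  clear hp
  revert a b c i j k
  decide +kernel

/-- A cell corner with a given label. -/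
def labelRep : ℕ → Fin 3 × Fin 3
  | 0 => (1, 2)
  | 1 => (0, 2)
  | 2 => (0, 1)
  | 3 => (0, 0)
  | 4 => (1, 1)
  | _ => (2, 2)

lemma rel_of_label_eq {p : Fin 3 → Fin 5} {X : Fin 3 × Fin 3 → Fin 3 × Fin 3 → Prop}
    (hX : Equivalence X) (hswap : ∀ i j, X (i, j) (j, i))
    (hcell : ∀ i j k, block (p i) j = block (p i) k → X (i, j) (i, k))
    {i j k l : Fin 3} (h : label p i j = label p k l) : X (i, j) (k, l) := by
  have hlink : ∀ i j k, linked p i j k = true → X (j, i) (k, i) := fun i j k hl =>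
    hX.trans (hswap j i) (hX.trans (hcell i j k (of_decide_eq_true hl)) (hswap i k))
  have hinner : ∀ a : Fin 3, X (labelRep a) (labelRep (innerLabel p a)) := by
    have h01 : linked p 2 0 1 = true → X (0, 2) (1, 2) := hlink 2 0 1
    have h02 : linked p 1 0 2 = true → X (0, 1) (1, 2) :=
      fun hl => hX.trans (hlink 1 0 2 hl) (hswap 2 1)
    have h12 : linked p 0 1 2 = true → X (0, 1) (0, 2) :=
      fun hl => hX.trans (hswap 0 1) (hX.trans (hlink 0 1 2 hl) (hswap 2 0))
    intro a
    fin_cases a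
    · exact hX.refl _
    · simp only [innerLabel]
      by_cases hc : (linked p 2 0 1 || (linked p 0 1 2 && linked p 1 0 2)) = true
      · rw [hc]
        simp only [Bool.or_eq_true, Bool.and_eq_true] at hc
        exact hc.elim h01 fun hc => hX.trans (hX.symm (h12 hc.1)) (h02 hc.2)
      · rw [Bool.not_eq_true] at hc
        rw [hc]
        exact hX.refl _
    · simp only [innerLabel]
      by_cases hc : (linked p 1 0 2 || (linked p 0 1 2 && linked p 2 0 1)) = true
      · rw [hc]
        simp only [Bool.or_eq_true, Bool.and_eq_true] at hc
        exact hc.elim h02 fun hc => hX.trans (h12 hc.1) (h01 hc.2)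
      · rw [Bool.not_eq_true] at hc
        rw [hc]
        by_cases hc' : linked p 0 1 2 = true
        · rw [hc']
          exact h12 hc'
        · rw [Bool.not_eq_true] at hc'
          rw [hc']
          exact hX.refl _
  have hnode : ∀ i j : Fin 3, i ≠ j → X (i, j) (labelRep (-(i + j) : Fin 3)) := by
    intro i j hij
    fin_cases i <;> fin_cases j <;> first | exact absurd rfl hij | exact hX.refl _ | exact hswap _ _
  have hcorner : ∀ i : Fin 3, (i, i) = labelRep (3 + i) := by decide
  have houter : ∀ i, X (i, i) (labelRep (outerLabel p i)) := by
    have hstep : ∀ i j : Fin 3, i ≠ j → linked p i i j = true →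
        X (i, i) (labelRep (innerLabel p (-(i + j)))) := fun i j hij hl =>
      hX.trans (hcell i i j (of_decide_eq_true hl)) (hX.trans (hnode i j hij) (hinner _))
    have hindex : ∀ i : Fin 3, -(i + (i + 1)) = i + 2 ∧ -(i + (i + 2)) = i + 1 ∧
        i ≠ i + 1 ∧ i ≠ i + 2 := by decide
    intro i
    obtain ⟨e1, e2, n1, n2⟩ := hindex i
    unfold outerLabel
    by_cases h1 : linked p i i (i + 1) = true
    · rw [h1]
      exact e1 ▸ hstep i (i + 1) n1 h1
    · rw [Bool.not_eq_true] at h1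
      rw [h1]
      by_cases h2 : linked p i i (i + 2) = true
      · rw [h2]
        exact e2 ▸ hstep i (i + 2) n2 h2
      · rw [Bool.not_eq_true] at h2
        rw [h2]
        exact (congrArg (X (i, i)) (hcorner i)).mp (hX.refl _)
  have hlabel : ∀ i j, X (i, j) (labelRep (label p i j)) := by
    intro i j
    by_cases hij : i = j
    · subst hij
      simpa [label] using houter i
    · simpa [label, hij] using hX.trans (hnode i j hij) (hinner _)
  exact hX.trans (hlabel i j) (h ▸ hX.symm (hlabel k l))

lemma glue_reachable_iff {n : ℕ} {p : Fin 3 → Fin 5} {F : Fin 3 → Finset (Sym2 Pt)}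
    (hF : ∀ i, F i ⊆ sierpE n) (hp : ∀ i, HasPartition n (p i) (F i)) (i j k l : Fin 3) :
    (graphOf (glue F)).Reachable (psi i (cornerPt j)) (psi k (cornerPt l)) ↔
      label p i j = label p k l := by
  constructor
  · intro h
    obtain ⟨i', j', z, hz, hez, hX, hr⟩ := exists_of_glue_reachable hF
      (fun i' j' => label p i j = label p i' j') (fun i' j' h => h.trans (label_swap p i' j'))
      (fun i' j' k' hr h => h.trans (label_eq_of_block_eq p i' j' k'
        (((hp i').reachable_iff j' k').mp hr))) rfl h
    by_cases hik : k = i'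
    · subst hik
      obtain rfl := psi_injective k hez
      exact hX.trans (label_eq_of_block_eq p k j' l (((hp k).reachable_iff j' l).mp hr))
    · obtain ⟨h1, rfl⟩ := eq_cornerPt_of_psi_eq (cornerPt_mem_sierpV n l) hz hik hez
      obtain rfl := cornerPt_injective h1
      rw [hX, label_swap p k l]
      exact label_eq_of_block_eq p l j' k (((hp l).reachable_iff j' k).mp hr)
  · intro h
    refine rel_of_label_eq (p := p) (X := fun a b => (graphOf (glue F)).Reachable
      (psi a.1 (cornerPt a.2)) (psi b.1 (cornerPt b.2)))
      ⟨fun _ => .refl _, fun h => h.symm, fun h h' => h.trans h'⟩ ?_ ?_ h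
    · intro i j
      rw [psi_cornerPt_comm]
    · intro i j k hb
      exact glue_reachable (((hp i).reachable_iff j k).mpr hb)

/-- Gluing forests with partitions `p` yields a forest with partition `σ`. -/
abbrev GluesTo (p : Fin 3 → Fin 5) (σ : Fin 5) : Prop :=
  (blockReps (p 0)).card + (blockReps (p 1)).card + (blockReps (p 2)).card =
      (blockReps σ).card + 3 ∧
    (∀ j k, label p j j = label p k k ↔ block σ j = block σ k) ∧
      ∀ i j, ∃ k, label p k k = label p i j

/-- `F` is a spanning forest of `G_n` each of whose components contains a corner, and which
induces the partition `σ` of the corners. -/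
structure IsForest (n : ℕ) (σ : Fin 5) (F : Finset (Sym2 Pt)) : Prop extends
    HasPartition n σ F where
  isAcyclic : (graphOf F).IsAcyclic

lemma hasPartition_glue_iff {n : ℕ} {p : Fin 3 → Fin 5} {F : Fin 3 → Finset (Sym2 Pt)}
    (hF : ∀ i, F i ⊆ sierpE n) (hp : ∀ i, HasPartition n (p i) (F i)) (σ : Fin 5) :
    HasPartition (n + 1) σ (glue F) ↔
      (∀ j k, label p j j = label p k k ↔ block σ j = block σ k) ∧
        ∀ i j, ∃ k, label p k k = label p i j := by
  have hr := glue_reachable_iff hF hp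
  constructor
  · rintro ⟨h1, h2⟩
    refine ⟨fun j k => ?_, fun i j => ?_⟩
    · rw [← hr, psi_cornerPt_self, psi_cornerPt_self, h1]
    · obtain ⟨k, hk⟩ := h2 _ (psi_mem_sierpV i (cornerPt_mem_sierpV n j))
      rw [← psi_cornerPt_self, hr] at hk
      exact ⟨k, hk⟩
  · rintro ⟨h1, h2⟩
    refine ⟨fun j k => ?_, fun x hx => ?_⟩
    · rw [← h1, ← hr, psi_cornerPt_self, psi_cornerPt_self]
    · obtain ⟨i, y, hy, rfl⟩ := mem_sierpV_succ.mp hx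
      obtain ⟨j, hj⟩ := (hp i).cover y hy
      obtain ⟨k, hk⟩ := h2 i j
      rw [← hr, psi_cornerPt_self] at hk
      exact ⟨k, hk.trans (glue_reachable hj)⟩

lemma isForest_glue_iff_gluesTo {n : ℕ} {p : Fin 3 → Fin 5} {F : Fin 3 → Finset (Sym2 Pt)}
    (hF : ∀ i, F i ⊆ sierpE n) (hp : ∀ i, IsForest n (p i) (F i)) (σ : Fin 5) :
    IsForest (n + 1) σ (glue F) ↔ GluesTo p σ := by
  have hiff := hasPartition_glue_iff hF (fun i => (hp i).toHasPartition) σ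
  have hacyc (h : HasPartition (n + 1) σ (glue F)) : (graphOf (glue F)).IsAcyclic ↔
      (blockReps (p 0)).card + (blockReps (p 1)).card + (blockReps (p 2)).card =
        (blockReps σ).card + 3 := by
    have hc (i : Fin 3) := ((hp i).isAcyclic_iff (hF i)).mp (hp i).isAcyclic
    have h0 := hc 0
    have h1 := hc 1
    have h2 := hc 2
    have hV := card_sierpV_succ n
    rw [h.isAcyclic_iff (glue_subset hF), card_glue hF]
    omega
  constructor
  · rintro ⟨h, ha⟩
    exact ⟨(hacyc h).mp ha, hiff.mp h⟩
  · rintro ⟨hc, h⟩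
    exact ⟨hiff.mpr h, (hacyc (hiff.mpr h)).mpr hc⟩

lemma IsForest.exists_of_glue {n : ℕ} {F : Fin 3 → Finset (Sym2 Pt)} {σ : Fin 5}
    (hF : ∀ i, F i ⊆ sierpE n) (h : IsForest (n + 1) σ (glue F)) :
    ∃ p : Fin 3 → Fin 5, ∀ i, IsForest n (p i) (F i) := by
  have hpart (i : Fin 3) : ∃ τ, ∀ j k,
      (graphOf (F i)).Reachable (cornerPt j) (cornerPt k) ↔ block τ j = block τ k :=
    exists_block_eq_iff ⟨fun _ => .refl _, fun h => h.symm, fun h h' => h.trans h'⟩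
  choose p hp using hpart
  refine ⟨p, fun i => ⟨⟨hp i, fun x hx => ?_⟩, isAcyclic_of_glue h.isAcyclic i⟩⟩
  obtain ⟨k, hk⟩ := h.cover _ (psi_mem_sierpV i hx)
  rw [← psi_cornerPt_self] at hk
  obtain ⟨i', j', z, hz, hez, -, hr⟩ := exists_of_glue_reachable hF (fun _ _ => True)
    (fun _ _ => id) (fun _ _ _ _ => id) trivial hk
  by_cases hi : i = i'
  · subst hi
    obtain rfl := psi_injective i hez
    exact ⟨j', hr⟩
  · exact ⟨i', (eq_cornerPt_of_psi_eq hx hz hi hez).1 ▸ .refl _⟩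

/-- The spanning forests of `G_n` with partition `σ` in which the degree of the corner `0`
satisfies `P`. -/
def forests (n : ℕ) (σ : Fin 5) (P : ℕ → Prop) : Finset (Finset (Sym2 Pt)) :=
  (sierpE n).powerset.filter fun F => IsForest n σ F ∧ P (degIn F (cornerPt 0))

lemma mem_forests {n : ℕ} {σ : Fin 5} {P : ℕ → Prop} {F : Finset (Sym2 Pt)} :
    F ∈ forests n σ P ↔ F ⊆ sierpE n ∧ IsForest n σ F ∧ P (degIn F (cornerPt 0)) := by
  simp [forests]

lemma card_forests_succ (n : ℕ) (σ : Fin 5) (P : ℕ → Prop) :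
    (forests (n + 1) σ P).card = ∑ p : Fin 3 → Fin 5 with GluesTo p σ,
      (forests n (p 0) P).card * (forests n (p 1) fun _ => True).card *
        (forests n (p 2) fun _ => True).card := by
  let Q : Fin 3 → ℕ → Prop := ![P, fun _ => True, fun _ => True]
  let A : (Fin 3 → Fin 5) → Finset (Fin 3 → Finset (Sym2 Pt)) := fun p =>
    Fintype.piFinset fun i => forests n (p i) (Q i)
  have hA {p : Fin 3 → Fin 5} {F : Fin 3 → Finset (Sym2 Pt)} : F ∈ A p ↔
      (∀ i, F i ⊆ sierpE n) ∧ (∀ i, IsForest n (p i) (F i)) ∧ P (degIn (F 0) (cornerPt 0)) := by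
    simp [A, Q, Fintype.mem_piFinset, mem_forests, Fin.forall_fin_succ]
    tauto
  have heq : forests (n + 1) σ P =
      ((Finset.univ.filter fun p => GluesTo p σ).biUnion A).image glue := by
    ext F
    simp only [Finset.mem_image, Finset.mem_biUnion, Finset.mem_filter, Finset.mem_univ, true_and,
      hA, mem_forests]
    constructor
    · rintro ⟨hF, h, hP⟩
      have hsub : ∀ i, unglue n F i ⊆ sierpE n := fun i => Finset.filter_subset _ _
      rw [← glue_unglue hF] at h hP
      rw [degIn_glue hsub] at hP
      obtain ⟨p, hp⟩ := h.exists_of_glue hsub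
      exact ⟨_, ⟨p, (isForest_glue_iff_gluesTo hsub hp σ).mp h, hsub, hp, hP⟩, glue_unglue hF⟩
    · rintro ⟨F, ⟨p, hpσ, hF, hp, hP⟩, rfl⟩
      exact ⟨glue_subset hF, (isForest_glue_iff_gluesTo hF hp σ).mpr hpσ, by rwa [degIn_glue hF]⟩
  rw [heq, Finset.card_image_of_injOn, Finset.card_biUnion]
  · refine Finset.sum_congr rfl fun p _ => ?_
    rw [Fintype.card_piFinset, Fin.prod_univ_three]
    rfl
  · intro p _ q _ hpq
    rw [Function.onFun, Finset.disjoint_left]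
    intro F hFp hFq
    refine hpq (funext fun i => block_ext fun j k => ?_)
    rw [← ((hA.mp hFp).2.1 i).reachable_iff, ← ((hA.mp hFq).2.1 i).reachable_iff]
  · have hsub : ∀ F ∈ (Finset.univ.filter fun p => GluesTo p σ).biUnion A,
        ∀ i, F i ⊆ sierpE n := by
      intro F hF
      obtain ⟨p, -, hp⟩ := Finset.mem_biUnion.mp hF
      exact (hA.mp hp).1
    intro F hF F' hF' h
    rw [← unglue_glue (hsub F hF), ← unglue_glue (hsub F' hF')]
    exact congrArg _ h

/-- The triples of partitions which glue to a given partition. -/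
def gluings : Fin 5 → List (Fin 3 → Fin 5)
  | 0 => [![0, 0, 1], ![0, 0, 2], ![0, 1, 0], ![0, 3, 0], ![2, 0, 0], ![3, 0, 0]]
  | 1 => [![0, 1, 1], ![1, 0, 1], ![1, 0, 2], ![1, 1, 0], ![1, 3, 0], ![2, 0, 1], ![3, 1, 0],
      ![4, 0, 0]]
  | 2 => [![0, 1, 2], ![0, 2, 1], ![0, 2, 2], ![0, 4, 0], ![2, 0, 2], ![2, 2, 0], ![2, 3, 0],
      ![3, 2, 0]]
  | 3 => [![0, 0, 4], ![0, 1, 3], ![0, 3, 1], ![0, 3, 3], ![2, 0, 3], ![3, 0, 2], ![3, 0, 3],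
      ![3, 3, 0]]
  | 4 => [![0, 1, 4], ![0, 2, 4], ![0, 4, 1], ![0, 4, 3], ![1, 0, 4], ![1, 1, 2], ![1, 1, 3],
      ![1, 2, 1], ![1, 2, 2], ![1, 3, 1], ![1, 3, 3], ![1, 4, 0], ![2, 0, 4], ![2, 2, 1],
      ![2, 2, 3], ![2, 3, 1], ![2, 3, 3], ![3, 1, 2], ![3, 1, 3], ![3, 2, 2], ![3, 2, 3],
      ![3, 4, 0], ![4, 0, 2], ![4, 0, 3], ![4, 2, 0], ![4, 3, 0]]

lemma gluesTo_iff_mem_gluings (p : Fin 3 → Fin 5) (σ : Fin 5) : GluesTo p σ ↔ p ∈ gluings σ := by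
  have hp : p = ![p 0, p 1, p 2] := by
    funext i
    fin_cases i <;> rfl
  rw [hp]
  generalize p 0 = a
  generalize p 1 = b
  generalize p 2 = c
  clear hp
  revert a b c σ
  decide +kernel

lemma nodup_gluings (σ : Fin 5) : (gluings σ).Nodup := by
  revert σ
  decide +kernel

lemma card_forests_succ_eq_sum_gluings (n : ℕ) (σ : Fin 5) (P : ℕ → Prop) :
    (forests (n + 1) σ P).card = ((gluings σ).map fun p =>
      (forests n (p 0) P).card * (forests n (p 1) fun _ => True).card *
        (forests n (p 2) fun _ => True).card).sum := by
  rw [card_forests_succ, ← List.sum_toFinset _ (nodup_gluings σ)]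
  refine Finset.sum_congr ?_ fun _ _ => rfl
  ext p
  simp only [Finset.mem_filter, Finset.mem_univ, true_and, List.mem_toFinset,
    gluesTo_iff_mem_gluings]

/-- The edge of the triangle `G_0` opposite to the corner `i`. -/
def oppositeEdge (i : Fin 3) : Sym2 Pt := s(cornerPt (i + 1), cornerPt (i + 2))

lemma oppositeEdge_injective : Function.Injective oppositeEdge := by
  intro i j h
  have : (s(i + 1, i + 2) : Sym2 (Fin 3)) = s(j + 1, j + 2) :=
    Sym2.map.injective cornerPt_injective (by simpa [oppositeEdge] using h)
  revert this
  clear h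
  revert i j
  decide

lemma sierpE_zero_eq_image : sierpE 0 = Finset.univ.image oppositeEdge := by
  ext e
  simp [mem_sierpE_zero, oppositeEdge]

/-- Whether the edges opposite to the corners in `A` connect the corners `j` and `k`. -/
abbrev TriangleConn (A : Finset (Fin 3)) (j k : Fin 3) : Prop :=
  j = k ∨ -(j + k) ∈ A ∨ (j ∈ A ∧ k ∈ A)

lemma reachable_image_oppositeEdge_iff (A : Finset (Fin 3)) (j k : Fin 3) :
    (graphOf (A.image oppositeEdge)).Reachable (cornerPt j) (cornerPt k) ↔ TriangleConn A j k := by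
  constructor
  · intro h
    have hstep : ∀ (A : Finset (Fin 3)) (j i : Fin 3), i ∈ A →
        (TriangleConn A j (i + 1) ↔ TriangleConn A j (i + 2)) := by decide +kernel
    have hconn : ∀ y, Relation.ReflTransGen (graphOf (A.image oppositeEdge)).Adj (cornerPt j) y →
        ∃ k, y = cornerPt k ∧ TriangleConn A j k := by
      intro y hy
      induction hy with
      | refl => exact ⟨j, rfl, Or.inl rfl⟩
      | tail _ hadj ih =>
        obtain ⟨k, rfl, hk⟩ := ih
        obtain ⟨i, hi, he⟩ := Finset.mem_image.mp (graphOf_adj.mp hadj).1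
        rcases Sym2.eq_iff.mp he with ⟨h1, rfl⟩ | ⟨rfl, h1⟩
        · obtain rfl := cornerPt_injective h1
          exact ⟨_, rfl, (hstep A j i hi).mp hk⟩
        · obtain rfl := cornerPt_injective h1
          exact ⟨_, rfl, (hstep A j i hi).mpr hk⟩
    obtain ⟨k', hk', hc⟩ := hconn _ ((SimpleGraph.reachable_iff_reflTransGen _ _).mp h)
    exact cornerPt_injective hk' ▸ hc
  · have hedge : ∀ j k : Fin 3, j ≠ k → -(j + k) ∈ A →
        (graphOf (A.image oppositeEdge)).Reachable (cornerPt j) (cornerPt k) := by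
      intro j k hjk hA
      refine (graphOf_adj.mpr ⟨Finset.mem_image.mpr ⟨_, hA, ?_⟩,
        cornerPt_injective.ne hjk⟩).reachable
      have : ∀ j k : Fin 3, j ≠ k → -(j + k) + 1 = j ∧ -(j + k) + 2 = k ∨
          -(j + k) + 1 = k ∧ -(j + k) + 2 = j := by decide
      rcases this j k hjk with ⟨h1, h2⟩ | ⟨h1, h2⟩
      · rw [oppositeEdge, h1, h2]
      · rw [oppositeEdge, h1, h2, Sym2.eq_swap]
    intro h
    by_cases hjk : j = k
    · subst hjk
      exact .refl _
    · rcases h with h | h | ⟨h1, h2⟩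
      · exact absurd h hjk
      · exact hedge j k hjk h
      · have hthird : ∀ j k : Fin 3, j ≠ k → j ≠ -(j + k) ∧ -(j + k) ≠ k ∧
            -(j + -(j + k)) = k ∧ -(-(j + k) + k) = j := by decide
        obtain ⟨n1, n2, e1, e2⟩ := hthird j k hjk
        exact (hedge j (-(j + k)) n1 (e1.symm ▸ h2)).trans (hedge _ k n2 (e2.symm ▸ h1))

lemma isForest_image_oppositeEdge_iff (A : Finset (Fin 3)) (σ : Fin 5) :
    IsForest 0 σ (A.image oppositeEdge) ↔ A.card + (blockReps σ).card = 3 ∧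
      ∀ j k, TriangleConn A j k ↔ block σ j = block σ k := by
  have hsub : A.image oppositeEdge ⊆ sierpE 0 := by
    rw [sierpE_zero_eq_image]
    exact Finset.image_subset_image (Finset.subset_univ A)
  have hacyc (h : HasPartition 0 σ (A.image oppositeEdge)) := h.isAcyclic_iff hsub
  rw [Finset.card_image_of_injective _ oppositeEdge_injective, card_sierpV_zero] at hacyc
  simp only [← reachable_image_oppositeEdge_iff]
  constructor
  · rintro ⟨h, ha⟩
    exact ⟨(hacyc h).mp ha, h.reachable_iff⟩
  · rintro ⟨hc, h⟩
    have hp : HasPartition 0 σ (A.image oppositeEdge) := by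
      refine ⟨h, fun x hx => ?_⟩
      obtain ⟨i, rfl⟩ := mem_sierpV_zero.mp hx
      exact ⟨i, .refl _⟩
    exact ⟨hp, (hacyc hp).mpr hc⟩

lemma degIn_image_oppositeEdge (A : Finset (Fin 3)) :
    degIn (A.image oppositeEdge) (cornerPt 0) = (A.erase 0).card := by
  have : (A.image oppositeEdge).filter (fun e => cornerPt 0 ∈ e) =
      (A.erase 0).image oppositeEdge := by
    have hmem : ∀ i : Fin 3, cornerPt 0 ∈ oppositeEdge i ↔ i ≠ 0 := by
      intro i
      rw [oppositeEdge, Sym2.mem_iff, cornerPt_injective.eq_iff, cornerPt_injective.eq_iff]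
      revert i
      decide
    ext e
    simp only [Finset.mem_filter, Finset.mem_image, Finset.mem_erase]
    constructor
    · rintro ⟨⟨i, hi, rfl⟩, h⟩
      exact ⟨i, ⟨(hmem i).mp h, hi⟩, rfl⟩
    · rintro ⟨i, ⟨h, hi⟩, rfl⟩
      exact ⟨⟨i, hi, rfl⟩, (hmem i).mpr h⟩
  rw [degIn, this, Finset.card_image_of_injective _ oppositeEdge_injective]

lemma card_forests_zero (σ : Fin 5) (P : ℕ → Prop) [DecidablePred P] :
    (forests 0 σ P).card = (Finset.univ.filter fun A : Finset (Fin 3) =>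
      (A.card + (blockReps σ).card = 3 ∧ ∀ j k, TriangleConn A j k ↔ block σ j = block σ k) ∧
        P (A.erase 0).card).card := by
  rw [← Finset.card_image_of_injective _ (Finset.image_injective oppositeEdge_injective)]
  congr 1
  ext F
  simp only [mem_forests, Finset.mem_image, Finset.mem_filter, Finset.mem_univ, true_and,
    ← isForest_image_oppositeEdge_iff, ← degIn_image_oppositeEdge]
  constructor
  · rintro ⟨hF, h⟩
    rw [sierpE_zero_eq_image] at hF
    obtain ⟨A, -, rfl⟩ := Finset.subset_image_iff.mp hF
    exact ⟨A, h, rfl⟩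
  · rintro ⟨A, h, rfl⟩
    refine ⟨?_, h⟩
    rw [sierpE_zero_eq_image]
    exact Finset.image_subset_image (Finset.subset_univ A)

/-- The closed-form relations between the numbers of spanning forests of each type. -/
lemma card_forests_relations (n : ℕ) :
    0 < (forests n 0 fun _ => True).card ∧ 0 < (forests n 1 fun _ => True).card ∧
    (forests n 2 fun _ => True).card = (forests n 1 fun _ => True).card ∧
    (forests n 3 fun _ => True).card = (forests n 1 fun _ => True).card ∧
    (forests n 0 fun _ => True).card * (forests n 4 fun _ => True).card =
      3 * (forests n 1 fun _ => True).card ^ 2 := by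
  induction n with
  | zero =>
    simp only [card_forests_zero]
    decide +kernel
  | succ n ih =>
    simp only [card_forests_succ_eq_sum_gluings]
    simp only [gluings, List.map_cons, List.map_nil, List.sum_cons, List.sum_nil,
      Matrix.cons_val_zero, Matrix.cons_val_one, Matrix.cons_val]
    obtain ⟨hT, hS, h2, h3, h4⟩ := ih
    rw [h2, h3]
    generalize (forests n 0 fun _ => True).card = T at *
    generalize (forests n 1 fun _ => True).card = S at *
    generalize (forests n 4 fun _ => True).card = R at *
    refine ⟨by positivity, by positivity, by ring, by ring, ?_⟩
    zify at *
    linear_combination -3 * T ^ 2 * (T * R - 7 * S ^ 2) * h4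

/-- The number of spanning forests in which the first corner has degree one. -/
lemma card_forests_degree_one (n : ℕ) :
    ((forests n 0 (· = 1)).card : ℝ) =
      (forests n 0 fun _ => True).card * (11 / 14 - 5 / 42 * (1 / 15) ^ n) ∧
    ((forests n 2 (· = 1)).card : ℝ) =
      (forests n 1 fun _ => True).card * (11 / 14 + 3 / 14 * (1 / 15) ^ n) ∧
    ((forests n 3 (· = 1)).card : ℝ) =
      (forests n 1 fun _ => True).card * (11 / 14 + 3 / 14 * (1 / 15) ^ n) := by
  induction n with
  | zero =>
    have h : (forests 0 0 (· = 1)).card = 2 ∧ (forests 0 0 fun _ => True).card = 3 ∧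
        (forests 0 2 (· = 1)).card = 1 ∧ (forests 0 3 (· = 1)).card = 1 ∧
        (forests 0 1 fun _ => True).card = 1 := by
      simp only [card_forests_zero]
      decide +kernel
    obtain ⟨h1, h2, h3, h4, h5⟩ := h
    rw [h1, h2, h3, h4, h5]
    norm_num
  | succ n ih =>
    obtain ⟨-, -, h2, h3, h4⟩ := card_forests_relations n
    simp only [card_forests_succ_eq_sum_gluings]
    simp only [gluings, List.map_cons, List.map_nil, List.sum_cons, List.sum_nil,
      Matrix.cons_val_zero, Matrix.cons_val_one, Matrix.cons_val]
    rw [h2, h3]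
    have h4' : ((forests n 0 fun _ => True).card : ℝ) * (forests n 4 fun _ => True).card =
      3 * (forests n 1 fun _ => True).card ^ 2 := by exact_mod_cast h4
    push_cast
    obtain ⟨i1, i2, i3⟩ := ih
    rw [i1, i2, i3, pow_succ]
    generalize ((forests n 0 fun _ => True).card : ℝ) = T at *
    generalize ((forests n 1 fun _ => True).card : ℝ) = S at *
    generalize ((forests n 4 fun _ => True).card : ℝ) = R at *
    generalize ((1 : ℝ) / 15) ^ n = q at *
    refine ⟨by ring, ?_, ?_⟩ <;>
      linear_combination T * ((11 / 14 - 5 / 42 * q) - (11 / 14 + 3 / 14 * (q * (1 / 15)))) * h4'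

lemma treeSet_eq_forests (n : ℕ) : treeSet n = forests n 0 fun _ => True := by
  have hblock : ∀ j k, block 0 j = block 0 k := by decide
  ext F
  simp only [treeSet, Finset.mem_filter, Finset.mem_powerset, mem_forests, and_true]
  refine and_congr_right fun _ => ⟨fun ⟨hac, h⟩ => ⟨⟨fun j k => ?_, fun x hx => ⟨0, ?_⟩⟩, hac⟩,
    fun h => ⟨h.isAcyclic, fun x hx y hy => ?_⟩⟩
  · exact iff_of_true (h _ (cornerPt_mem_sierpV n j) _ (cornerPt_mem_sierpV n k)) (hblock j k)
  · exact h _ (cornerPt_mem_sierpV n 0) _ hx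
  · obtain ⟨j, hj⟩ := h.cover x hx
    obtain ⟨k, hk⟩ := h.cover y hy
    exact hj.symm.trans (((h.reachable_iff j k).2 (hblock j k)).trans hk)

lemma card_treeSet_degree_one (n : ℕ) :
    ((treeSet n).filter fun t => degIn t (cornerPt 0) = 1).card = (forests n 0 (· = 1)).card := by
  congr 1
  ext F
  simp only [treeSet_eq_forests, Finset.mem_filter, mem_forests, and_true, and_assoc]

lemma degIn_mono {F F' : Finset (Sym2 Pt)} (h : F ⊆ F') (x : Pt) : degIn F x ≤ degIn F' x :=
  Finset.card_le_card (Finset.filter_subset_filter _ h)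

lemma degIn_sierpE (n : ℕ) : degIn (sierpE n) (cornerPt 0) = 2 := by
  induction n with
  | zero =>
    rw [sierpE_zero_eq_image, degIn_image_oppositeEdge]
    decide
  | succ n ih =>
    have : sierpE (n + 1) = glue fun _ => sierpE n := by
      ext e
      rw [mem_sierpE_succ, mem_glue]
    rw [this, degIn_glue fun _ => subset_rfl, ih]

lemma degIn_pos {F : Finset (Sym2 Pt)} {x y : Pt} (hxy : x ≠ y) (h : (graphOf F).Reachable x y) :
    0 < degIn F x := by
  obtain ⟨w⟩ := h
  cases w with
  | nil => exact absurd rfl hxy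
  | cons hadj _ =>
    exact Finset.card_pos.2 ⟨_, Finset.mem_filter.2 ⟨(graphOf_adj.1 hadj).1, Sym2.mem_mk_left _ _⟩⟩

lemma degIn_eq_one_or_two {n : ℕ} {t : Finset (Sym2 Pt)} (ht : t ∈ treeSet n) :
    degIn t (cornerPt 0) = 1 ∨ degIn t (cornerPt 0) = 2 := by
  simp only [treeSet, Finset.mem_filter, Finset.mem_powerset] at ht
  have hle := (degIn_mono ht.1 (cornerPt 0)).trans_eq (degIn_sierpE n)
  have hpos : 0 < degIn t (cornerPt 0) :=
    degIn_pos (cornerPt_injective.ne (by decide : (0 : Fin 3) ≠ 1))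
      (ht.2.2 _ (cornerPt_mem_sierpV n 0) _ (cornerPt_mem_sierpV n 1))
  omega

lemma card_treeSet_pos (n : ℕ) : 0 < (treeSet n).card := by
  rw [treeSet_eq_forests]
  exact (card_forests_relations n).1

lemma degree_one_probability (n : ℕ) :
    (((treeSet n).filter fun t => degIn t (cornerPt 0) = 1).card : ℝ) / ((treeSet n).card : ℝ) =
      11 / 14 - 5 / 42 * (1 / 15) ^ n := by
  have hT : ((treeSet n).card : ℝ) ≠ 0 := by exact_mod_cast (card_treeSet_pos n).ne'
  rw [div_eq_iff hT, card_treeSet_degree_one, (card_forests_degree_one n).1, treeSet_eq_forests,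
    mul_comm]

lemma degree_two_probability (n : ℕ) :
    (((treeSet n).filter fun t => degIn t (cornerPt 0) = 2).card : ℝ) / ((treeSet n).card : ℝ) =
      3 / 14 + 5 / 42 * (1 / 15) ^ n := by
  have hT : ((treeSet n).card : ℝ) ≠ 0 := by exact_mod_cast (card_treeSet_pos n).ne'
  have hsum : ((treeSet n).filter fun t => degIn t (cornerPt 0) = 1).card +
      ((treeSet n).filter fun t => degIn t (cornerPt 0) = 2).card = (treeSet n).card := by
    rw [← Finset.card_filter_add_card_filter_not (s := treeSet n)
      (fun t => degIn t (cornerPt 0) = 1)]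
    congr 2
    refine Finset.filter_congr fun t ht => ?_
    have := degIn_eq_one_or_two ht
    omega
  have h1 := degree_one_probability n
  rw [div_eq_iff hT] at h1 ⊢
  have hsum' := congrArg (Nat.cast (R := ℝ)) hsum
  push_cast at hsum'
  linarith

/-- degree of the corner `u₁` in a uniformly random spanning tree of `G_n`. -/
theorem corner_degree_ust :
    (∀ n : ℕ,
        (((treeSet n).filter fun t => degIn t (cornerPt 0) = 1).card : ℝ) /
            ((treeSet n).card : ℝ) = 11 / 14 - 5 / 42 * (1 / 15) ^ n ∧
          (((treeSet n).filter fun t => degIn t (cornerPt 0) = 2).card : ℝ) /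
            ((treeSet n).card : ℝ) = 3 / 14 + 5 / 42 * (1 / 15) ^ n ∧
          ∀ t ∈ treeSet n, degIn t (cornerPt 0) = 1 ∨ degIn t (cornerPt 0) = 2) ∧
      Tendsto (fun n : ℕ =>
          (((treeSet n).filter fun t => degIn t (cornerPt 0) = 1).card : ℝ) /
            ((treeSet n).card : ℝ)) atTop (nhds (11 / 14)) ∧
      Tendsto (fun n : ℕ =>
          (((treeSet n).filter fun t => degIn t (cornerPt 0) = 2).card : ℝ) /
            ((treeSet n).card : ℝ)) atTop (nhds (3 / 14)) := by
  have hpow : Tendsto (fun n : ℕ => (5 / 42 : ℝ) * (1 / 15) ^ n) atTop (nhds 0) := by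
    simpa using (tendsto_pow_atTop_nhds_zero_of_lt_one (r := (1 / 15 : ℝ)) (by norm_num)
      (by norm_num)).const_mul (5 / 42)
  refine ⟨fun n => ⟨degree_one_probability n, degree_two_probability n,
    fun t => degIn_eq_one_or_two⟩, ?_, ?_⟩
  · simp only [degree_one_probability]
    simpa using hpow.const_sub (11 / 14)
  · simp only [degree_two_probability]
    simpa using hpow.const_add (3 / 14)

end
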